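/- Let b_c := (2R Σ_{i=1}^∞ θ_i ρ^{i−1})^{-s} and for b ∈ ℝ let E^*(b) := {x ∈ E : Θ^{*s}(μ,x) ≤ b}. Then: (i) if b < b_c then E^*(b) is at most countable; (ii) if b = b_c then E^*(b) is uncountable; (iii) if b > b_c then dim_H E^*(b) > 0. -/

import Mathlib

open MeasureTheory Filter Set Topology ENNReal

namespace HomogeneousCantorDensity

noncomputable def R (N : ℕ) (ρ : ℝ) : ℝ := (1 - ρ) / ((N : ℝ) - 1)

noncomputable def f (N : ℕ) (ρ : ℝ) (i : ℕ) (x : ℝ) : ℝ := ρ * x + (i : ℝ) * R N ρ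

noncomputable def piMap (N : ℕ) (ρ : ℝ) (d : ℕ → ℕ) : ℝ :=
  R N ρ * ∑' i : ℕ, (d i : ℝ) * ρ ^ i

def cantorE (N : ℕ) (ρ : ℝ) : Set ℝ :=
  {x | ∃ d : ℕ → ℕ, (∀ i, d i < N) ∧ x = piMap N ρ d}

/-- `μ = ∑_{i=0}^{N-1} (1/N) μ ∘ f_i⁻¹`. -/
def IsSelfSimilar (N : ℕ) (ρ : ℝ) (μ : Measure ℝ) : Prop :=
  μ = ∑ i ∈ Finset.range N, (N : ℝ≥0∞)⁻¹ • μ.map (f N ρ i)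

/-- `T^n x` for `x = piMap N ρ d`. -/
noncomputable def Tn (N : ℕ) (ρ : ℝ) (d : ℕ → ℕ) (n : ℕ) : ℝ :=
  piMap N ρ (fun i => d (n + i))

/-- pointwise lower `s`-density of `μ` at `x`. -/
noncomputable def lowerDensity (μ : Measure ℝ) (s x : ℝ) : ℝ :=
  liminf (fun r : ℝ => (μ (Ioo (x - r) (x + r))).toReal / (2 * r) ^ s) (𝓝[>] 0)

/-- pointwise upper `s`-density of `μ` at `x`. -/
noncomputable def upperDensity (μ : Measure ℝ) (s x : ℝ) : ℝ :=
  limsup (fun r : ℝ => (μ (Ioo (x - r) (x + r))).toReal / (2 * r) ^ s) (𝓝[>] 0)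

section aux

variable {N : ℕ} {ρ : ℝ}

lemma rho_lt (hN : 2 ≤ N) (hρ1 : ρ ≤ 1 / (N : ℝ) ^ 2) : ρ ≤ 1 / 4 := by
  have h : (2:ℝ) ≤ N := by exact_mod_cast hN
  refine hρ1.trans ?_
  rw [div_le_div_iff₀ (by positivity) (by norm_num)]
  nlinarith

lemma rho_mul (hN : 2 ≤ N) (hρ1 : ρ ≤ 1 / (N : ℝ) ^ 2) : ρ * (N:ℝ) ^ 2 ≤ 1 := by
  have h : (2:ℝ) ≤ N := by exact_mod_cast hN
  rwa [le_div_iff₀ (by positivity)] at hρ1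

lemma R_mul (hN : 2 ≤ N) : ((N:ℝ) - 1) * R N ρ = 1 - ρ := by
  have h : (2:ℝ) ≤ N := by exact_mod_cast hN
  unfold R
  have : (N:ℝ) - 1 ≠ 0 := by linarith
  field_simp

lemma R_pos (hN : 2 ≤ N) (hρ1 : ρ ≤ 1 / (N : ℝ) ^ 2) : 0 < R N ρ := by
  have h : (2:ℝ) ≤ N := by exact_mod_cast hN
  have := rho_lt hN hρ1
  unfold R
  apply div_pos <;> linarith

/-- `R ≥ 3 ρ`. -/
lemma R_ge (hN : 2 ≤ N) (hρ0 : 0 < ρ) (hρ1 : ρ ≤ 1 / (N : ℝ) ^ 2) : 3 * ρ ≤ R N ρ := by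
  have h : (2:ℝ) ≤ N := by exact_mod_cast hN
  have h2 := rho_mul hN hρ1
  unfold R
  rw [le_div_iff₀ (by linarith)]
  nlinarith [mul_nonneg hρ0.le (mul_nonneg (by linarith : (0:ℝ) ≤ N - 2) (by linarith : (0:ℝ) ≤ N - 1))]

lemma summ (hρ0 : 0 < ρ) (hρ : ρ ≤ 1/4) (d : ℕ → ℕ) (hd : ∀ i, d i < N) :
    Summable (fun i => (d i : ℝ) * ρ ^ i) := by
  refine Summable.of_nonneg_of_le (fun i => by positivity) (fun i => ?_)
    ((summable_geometric_of_lt_one hρ0.le (by linarith)).mul_left (N:ℝ))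
  have : (d i : ℝ) ≤ N := by exact_mod_cast (hd i).le
  gcongr

lemma piMap_rec (hρ0 : 0 < ρ) (hρ : ρ ≤ 1/4) (d : ℕ → ℕ) (hd : ∀ i, d i < N) :
    piMap N ρ d = (d 0 : ℝ) * R N ρ + ρ * piMap N ρ (fun i => d (1 + i)) := by
  unfold piMap
  rw [(summ hρ0 hρ d hd).tsum_eq_zero_add]
  have : ∑' (b : ℕ), (d (b + 1) : ℝ) * ρ ^ (b + 1) = ρ * ∑' (i : ℕ), (d (1 + i) : ℝ) * ρ ^ i := by
    rw [← tsum_mul_left]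
    congr 1; ext i; rw [add_comm 1 i]; ring
  rw [this]; ring

lemma piMap_add (hN : 2 ≤ N) (hρ0 : 0 < ρ) (hρ : ρ ≤ 1/4) (d d' : ℕ → ℕ) (hd : ∀ i, d i + d' i = N - 1) :
    piMap N ρ d + piMap N ρ d' = 1 := by
  unfold piMap
  rw [← mul_add, ← (summ (N := N) hρ0 hρ d (fun i => by have := hd i; omega)).tsum_add
    (summ (N := N) hρ0 hρ d' (fun i => by have := hd i; omega))]
  have : ∀ i, (d i : ℝ) * ρ ^ i + (d' i : ℝ) * ρ ^ i = ((N:ℝ) - 1) * ρ ^ i := by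
    intro i
    have h : ((d i + d' i : ℕ) : ℝ) = ((N - 1 : ℕ) : ℝ) := by rw [hd i]
    rw [Nat.cast_sub (by omega)] at h
    push_cast at h
    rw [← h]; ring
  simp_rw [this]
  rw [tsum_mul_left, tsum_geometric_of_lt_one hρ0.le (by linarith), ← mul_assoc, mul_comm (R N ρ), R_mul hN]
  have : 1 - ρ ≠ 0 := by linarith
  field_simp

lemma piMap_nonneg (hN : 2 ≤ N) (hρ0 : 0 < ρ) (hρ1 : ρ ≤ 1 / (N : ℝ) ^ 2) (d : ℕ → ℕ) : 0 ≤ piMap N ρ d := by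
  unfold piMap
  exact mul_nonneg (R_pos hN hρ1).le (tsum_nonneg (fun i => by positivity))

lemma piMap_le (hN : 2 ≤ N) (hρ0 : 0 < ρ) (hρ1 : ρ ≤ 1 / (N : ℝ) ^ 2) (d : ℕ → ℕ)
    (hd : ∀ i, d i < N) : piMap N ρ d ≤ 1 := by
  have := piMap_add hN hρ0 (rho_lt hN hρ1) d (fun i => N - 1 - d i) (fun i => by have := hd i; omega)
  have := piMap_nonneg hN hρ0 hρ1 (fun i => N - 1 - d i)
  linarith


/-- digits of a boolean sequence -/
def dig (N : ℕ) (e : ℕ → Bool) (i : ℕ) : ℕ := if e i then N - 1 else 0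

noncomputable def val (N : ℕ) (ρ : ℝ) (e : ℕ → Bool) : ℝ := piMap N ρ (dig N e)

lemma dig_lt (hN : 2 ≤ N) (e : ℕ → Bool) (i : ℕ) : dig N e i < N := by
  unfold dig; split <;> omega

lemma val_rec (hN : 2 ≤ N) (hρ0 : 0 < ρ) (hρ1 : ρ ≤ 1 / (N : ℝ) ^ 2) (e : ℕ → Bool) :
    val N ρ e = (if e 0 then 1 - ρ else 0) + ρ * val N ρ (fun i => e (1 + i)) := by
  unfold val
  rw [piMap_rec hρ0 (rho_lt hN hρ1) _ (dig_lt hN e)]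
  congr 1
  unfold dig
  split
  · rw [Nat.cast_sub (by omega)]; push_cast; rw [R_mul hN]
  · simp

lemma val_nonneg (hN : 2 ≤ N) (hρ0 : 0 < ρ) (hρ1 : ρ ≤ 1 / (N : ℝ) ^ 2) (e : ℕ → Bool) :
    0 ≤ val N ρ e := piMap_nonneg hN hρ0 hρ1 _

lemma val_le (hN : 2 ≤ N) (hρ0 : 0 < ρ) (hρ1 : ρ ≤ 1 / (N : ℝ) ^ 2) (e : ℕ → Bool) :
    val N ρ e ≤ 1 := piMap_le hN hρ0 hρ1 _ (dig_lt hN e)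

lemma val_not (hN : 2 ≤ N) (hρ0 : 0 < ρ) (hρ1 : ρ ≤ 1 / (N : ℝ) ^ 2) (e : ℕ → Bool) :
    val N ρ e + val N ρ (fun i => !(e i)) = 1 := by
  unfold val
  apply piMap_add hN hρ0 (rho_lt hN hρ1)
  intro i
  unfold dig
  cases h : e i <;> simp [h]

lemma val_close (hN : 2 ≤ N) (hρ0 : 0 < ρ) (hρ1 : ρ ≤ 1 / (N : ℝ) ^ 2) (k : ℕ) :
    ∀ a b : ℕ → Bool, (∀ i < k, a i = b i) → val N ρ a ≤ val N ρ b + ρ ^ k := by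
  induction k with
  | zero =>
    intro a b _
    have := val_le hN hρ0 hρ1 a
    have := val_nonneg hN hρ0 hρ1 b
    simp; linarith
  | succ k ih =>
    intro a b h
    rw [val_rec hN hρ0 hρ1 a, val_rec hN hρ0 hρ1 b, h 0 (by omega)]
    have := ih (fun i => a (1 + i)) (fun i => b (1 + i)) (fun i hi => h (1 + i) (by omega))
    have := mul_le_mul_of_nonneg_left this hρ0.le
    rw [pow_succ]
    linarith

lemma val_diff (hN : 2 ≤ N) (hρ0 : 0 < ρ) (hρ1 : ρ ≤ 1 / (N : ℝ) ^ 2) (j : ℕ) :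
    ∀ a b : ℕ → Bool, (∀ i < j, a i = b i) → a j = false → b j = true →
      val N ρ a + ρ ^ j * (1 / 2) ≤ val N ρ b := by
  have hr := rho_lt hN hρ1
  induction j with
  | zero =>
    intro a b _ ha hb
    rw [val_rec hN hρ0 hρ1 a, val_rec hN hρ0 hρ1 b, ha, hb]
    have h1 := val_le hN hρ0 hρ1 (fun i => a (1 + i))
    have h2 := val_nonneg hN hρ0 hρ1 (fun i => b (1 + i))
    simp
    nlinarith
  | succ k ih =>
    intro a b h ha hb
    rw [val_rec hN hρ0 hρ1 a, val_rec hN hρ0 hρ1 b, h 0 (by omega)]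
    have := ih (fun i => a (1 + i)) (fun i => b (1 + i)) (fun i hi => h (1 + i) (by omega))
      (by simpa [add_comm] using ha) (by simpa [add_comm] using hb)
    have := mul_le_mul_of_nonneg_left this hρ0.le
    rw [pow_succ]
    linarith

/-- strict lexicographic order on prefixes of length `k` -/
def Llt (k : ℕ) (a b : ℕ → Bool) : Prop :=
  ∃ j < k, (∀ i < j, a i = b i) ∧ a j = false ∧ b j = true

lemma tri (k : ℕ) (a b : ℕ → Bool) : Llt k a b ∨ (∀ i < k, a i = b i) ∨ Llt k b a := by
  induction k with
  | zero => right; left; intro i hi; omega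
  | succ k ih =>
    rcases ih with ⟨j, hj, h⟩ | h | ⟨j, hj, h⟩
    · exact Or.inl ⟨j, by omega, h⟩
    · by_cases hk : a k = b k
      · right; left; intro i hi
        rcases Nat.lt_succ_iff_lt_or_eq.mp hi with h' | h'
        · exact h i h'
        · rw [h', hk]
      · cases ha : a k <;> cases hb : b k
        · simp [ha, hb] at hk
        · exact Or.inl ⟨k, by omega, h, ha, hb⟩
        · exact Or.inr (Or.inr ⟨k, by omega, fun i hi => (h i hi).symm, hb, ha⟩)
        · simp [ha, hb] at hk
    · exact Or.inr (Or.inr ⟨j, by omega, h⟩)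

lemma val_le_of_not_Llt (hN : 2 ≤ N) (hρ0 : 0 < ρ) (hρ1 : ρ ≤ 1 / (N : ℝ) ^ 2) (k : ℕ)
    (a b : ℕ → Bool) (h : ¬ Llt k b a) : val N ρ a ≤ val N ρ b + ρ ^ k := by
  rcases tri k a b with ⟨j, hj, h1, h2, h3⟩ | h' | h'
  · have := val_diff hN hρ0 hρ1 j a b h1 h2 h3
    have : 0 < ρ ^ j := by positivity
    have : 0 < ρ ^ k := by positivity
    linarith
  · exact val_close hN hρ0 hρ1 k a b h'
  · exact absurd h' h

lemma val_inj (hN : 2 ≤ N) (hρ0 : 0 < ρ) (hρ1 : ρ ≤ 1 / (N : ℝ) ^ 2) (a b : ℕ → Bool)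
    (h : val N ρ a = val N ρ b) : a = b := by
  ext1 n
  rcases tri (n + 1) a b with ⟨j, hj, h1, h2, h3⟩ | h' | ⟨j, hj, h1, h2, h3⟩
  · have := val_diff hN hρ0 hρ1 j a b h1 h2 h3
    have : 0 < ρ ^ j := by positivity
    linarith
  · exact h' n (by omega)
  · have := val_diff hN hρ0 hρ1 j b a h1 h2 h3
    have : 0 < ρ ^ j := by positivity
    linarith

/-- `n`-th shift normalised to start with `true` -/
def nrm (e : ℕ → Bool) (n : ℕ) (i : ℕ) : Bool := e (n + i) == e n

/-- distance from `y` to the farther end of `[0,1]` -/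
noncomputable def gam (y : ℝ) : ℝ := max y (1 - y)

lemma gam_val (hN : 2 ≤ N) (hρ0 : 0 < ρ) (hρ1 : ρ ≤ 1 / (N : ℝ) ^ 2) (e : ℕ → Bool) (n : ℕ) :
    gam (val N ρ (fun i => e (n + i))) = val N ρ (nrm e n) := by
  have hr := rho_lt hN hρ1
  have h1 := val_le hN hρ0 hρ1 (fun i => e (n + (1 + i)))
  have h2 := val_nonneg hN hρ0 hρ1 (fun i => e (n + (1 + i)))
  have hrec := val_rec hN hρ0 hρ1 (fun i => e (n + i))
  unfold gam
  cases h : e n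
  · have : nrm e n = (fun i => !(e (n + i))) := by ext i; simp [nrm, h]
    rw [this]
    have h3 := val_not hN hρ0 hρ1 (fun i => e (n + i))
    simp [h] at hrec
    rw [max_eq_right]
    · linarith
    · nlinarith
  · have : nrm e n = (fun i => (e (n + i))) := by ext i; simp [nrm, h]
    rw [this]
    simp [h] at hrec
    rw [max_eq_left]
    nlinarith


/-- `θ` is the (boolean) Thue-Morse sequence starting with `true`. -/
def IsTM (θ : ℕ → Bool) : Prop :=
  θ 0 = true ∧ ∀ n j : ℕ, j < 2 ^ n → θ (2 ^ n + j) = !(θ j)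

lemma IsTM.even_odd {θ : ℕ → Bool} (h : IsTM θ) (i : ℕ) :
    θ (2 * i) = θ i ∧ θ (2 * i + 1) = !(θ i) := by
  induction i using Nat.strong_induction_on with
  | _ i ih =>
    rcases Nat.eq_zero_or_pos i with rfl | hi
    · refine ⟨rfl, ?_⟩
      have := h.2 0 0 (by norm_num)
      simpa using this
    · have h1 : 2 ^ (Nat.log 2 i) ≤ i := Nat.pow_log_le_self 2 (by omega)
      have h2 : i < 2 ^ (Nat.log 2 i + 1) := Nat.lt_pow_succ_log_self (by norm_num) i
      obtain ⟨j, hj⟩ := Nat.exists_eq_add_of_le h1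
      generalize Nat.log 2 i = n at *
      have h0 : 0 < 2 ^ n := by positivity
      rw [pow_succ] at h2
      obtain ⟨e1, e2⟩ := ih j (by omega)
      have a1 := h.2 n j (by omega)
      have a2 := h.2 (n + 1) (2 * j) (by rw [pow_succ]; omega)
      have a3 := h.2 (n + 1) (2 * j + 1) (by rw [pow_succ]; omega)
      rw [pow_succ] at a2 a3
      rw [show 2 * i + 1 = 2 ^ n * 2 + (2 * j + 1) by omega, show 2 * i = 2 ^ n * 2 + 2 * j by omega,
        a2, a3, e1, e2, hj, a1]
      simp

lemma IsTM.block {θ : ℕ → Bool} (h : IsTM θ) (m : ℕ) : ∀ a i : ℕ, i < 2 ^ m →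
    θ (2 ^ m * a + i) = (θ a == θ i) := by
  induction m with
  | zero =>
    intro a i hi
    have : i = 0 := by simpa using hi
    subst this
    simp [h.1]
  | succ m ih =>
    intro a i hi
    rw [pow_succ] at hi
    obtain ⟨k, rfl | rfl⟩ : ∃ k, i = 2 * k ∨ i = 2 * k + 1 := ⟨i / 2, by omega⟩
    · rw [show 2 ^ (m + 1) * a + 2 * k = 2 * (2 ^ m * a + k) by ring, (h.even_odd _).1,
        (h.even_odd _).1, ih a k (by omega)]
    · rw [show 2 ^ (m + 1) * a + (2 * k + 1) = 2 * (2 ^ m * a + k) + 1 by ring, (h.even_odd _).2,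
        (h.even_odd _).2, ih a k (by omega)]
      cases θ a <;> cases θ k <;> rfl

/-- key step: matching of blocks propagates -/
lemma step {θ : ℕ → Bool} (h : IsTM θ) (e : ℕ → Bool) (m : ℕ)
    (hS : ∀ n, Llt (2 ^ (m + 2)) θ (nrm e n)) (n : ℕ)
    (hn : ∀ i < 2 ^ (m + 1), nrm e n i = θ i) :
    e (n + 2 ^ m) = !(e n) ∧ ∀ i < 2 ^ (m + 1), nrm e (n + 2 ^ m) i = θ i := by
  have H := h.2 m
  have H' := h.2 (m + 1)
  rw [show 2 ^ (m + 2) = 4 * 2 ^ m by ring] at hS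
  rw [show 2 ^ (m + 1) = 2 * 2 ^ m by ring] at hn H' ⊢
  have hp : 0 < 2 ^ m := by positivity
  generalize 2 ^ m = q at *
  have h0 := h.1
  have e1 : e (n + q) = !(e n) := by
    have := hn q (by omega)
    have h3 := H 0 hp
    rw [add_zero, h0] at h3
    rw [h3] at this
    unfold nrm at this
    revert this
    cases e (n + q) <;> cases e n <;> simp
  -- first step
  have e2 : e (n + 2 * q) = e n := by
    by_contra hne
    obtain ⟨j, hj, k1, k2, k3⟩ := hS n
    obtain ⟨j', hj', l1, l2, l3⟩ := hS (n + 2 * q)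
    have hj2 : 2 * q ≤ j := by
      by_contra hlt
      have := hn j (by omega)
      rw [k2, k3] at this
      simp at this
    obtain ⟨t, rfl⟩ := Nat.exists_eq_add_of_le hj2
    have ht : θ t = true := by
      have := H' t (by omega)
      rw [k2] at this
      revert this; cases θ t <;> simp
    have key : ∀ i, nrm e (n + 2 * q) i = !(nrm e n (2 * q + i)) := by
      intro i
      unfold nrm
      rw [add_assoc]
      revert hne
      cases e (n + 2 * q) <;> cases e n <;> simp
    rcases lt_trichotomy j' t with hlt | rfl | hgt
    · have a1 := k1 (2 * q + j') (by omega)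
      have a2 := H' j' (by omega)
      rw [key, ← a1, a2, l2] at l3
      simp at l3
    · rw [ht] at l2; simp at l2
    · have a1 := l1 t hgt
      rw [key, k3, ht] at a1
      simp at a1
  refine ⟨e1, ?_⟩
  obtain ⟨j, hj, k1, k2, k3⟩ := hS (n + 2 * q)
  obtain ⟨j', hj', l1, l2, l3⟩ := hS (n + q)
  have key : ∀ i, nrm e (n + q) (q + i) = !(nrm e (n + 2 * q) i) := by
    intro i
    unfold nrm
    rw [e1, e2, show n + q + (q + i) = n + 2 * q + i by ring]
    cases e n <;> cases e (n + 2 * q + i) <;> rfl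
  have fin : 2 * q ≤ j' := by
    by_contra hlt
    rcases lt_or_ge j' q with hq | hq
    · have a1 := hn (q + j') (by omega)
      rw [H j' hq, l2] at a1
      unfold nrm at a1 l3
      rw [e1, add_assoc] at l3
      revert a1 l3
      cases e n <;> cases e (n + (q + j')) <;> simp
    · obtain ⟨t, rfl⟩ := Nat.exists_eq_add_of_le hq
      have ht : θ t = true := by
        have := H t (by omega)
        rw [l2] at this
        revert this; cases θ t <;> simp
      rw [key] at l3
      rcases lt_trichotomy j t with hlt | rfl | hgt
      · have a1 := l1 (q + j) (by omega)
        rw [key, H j (by omega), k2, k3] at a1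
        simp at a1
      · rw [ht] at k2; simp at k2
      · have a1 := k1 t hgt
        rw [ht] at a1
        rw [← a1] at l3
        simp at l3
  intro i hi
  exact (l1 i (by omega)).symm

/-- eventual periodicity -/
def EvPer {α : Type*} (e : ℕ → α) : Prop := ∃ n p : ℕ, 0 < p ∧ ∀ k, n ≤ k → e (k + p) = e k

lemma evPer_of_Llt {θ : ℕ → Bool} (h : IsTM θ) (e : ℕ → Bool) (m : ℕ)
    (hS : ∀ n, Llt (2 ^ m) θ (nrm e n)) : EvPer e := by
  induction m with
  | zero =>
    obtain ⟨j, hj, -, h1, -⟩ := hS 0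
    have : j = 0 := by simpa using hj
    rw [this, h.1] at h1
    simp at h1
  | succ m ih =>
    by_cases hm : ∀ n, Llt (2 ^ m) θ (nrm e n)
    · exact ih hm
    push Not at hm
    obtain ⟨n, hn⟩ := hm
    have hn : ∀ i < 2 ^ m, nrm e n i = θ i := by
      obtain ⟨j, hj, h1, h2, h3⟩ := hS n
      have : 2 ^ m ≤ j := by
        by_contra hlt
        exact hn ⟨j, by omega, h1, h2, h3⟩
      intro i hi
      exact (h1 i (by omega)).symm
    cases m with
    | zero =>
      refine ⟨0, 1, by norm_num, fun k _ => ?_⟩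
      obtain ⟨j, hj, h1, h2, h3⟩ := hS k
      have hj1 : j = 1 := by
        have : j ≠ 0 := by rintro rfl; rw [h.1] at h2; simp at h2
        simp at hj; omega
      subst hj1
      simpa [nrm] using h3
    | succ m =>
      have st := step h e m hS
      have all : ∀ c, ∀ i < 2 ^ (m + 1), nrm e (n + 2 ^ m * c) i = θ i := by
        intro c
        induction c with
        | zero => simpa using hn
        | succ c ihc =>
          have := (st _ ihc).2
          rwa [show n + 2 ^ m * (c + 1) = n + 2 ^ m * c + 2 ^ m by ring]
      have half : ∀ k, n ≤ k → e (k + 2 ^ m) = !(e k) := by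
        intro k hk
        have hp : 0 < 2 ^ m := by positivity
        obtain ⟨c, i, hi, rfl⟩ : ∃ c i, i < 2 ^ m ∧ k = n + 2 ^ m * c + i := by
          refine ⟨(k - n) / 2 ^ m, (k - n) % 2 ^ m, Nat.mod_lt _ hp, ?_⟩
          have := Nat.div_add_mod (k - n) (2 ^ m)
          omega
        have a1 := (all c) i (by rw [pow_succ]; omega)
        have a2 := (all (c + 1)) i (by rw [pow_succ]; omega)
        have a3 := (st _ (all c)).1
        rw [← a1] at a2
        unfold nrm at a2
        rw [show n + 2 ^ m * (c + 1) = n + 2 ^ m * c + 2 ^ m by ring, a3] at a2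
        rw [show n + 2 ^ m * c + i + 2 ^ m = n + 2 ^ m * c + 2 ^ m + i by ring]
        revert a2
        cases e (n + 2 ^ m * c + 2 ^ m + i) <;> cases e (n + 2 ^ m * c) <;>
          cases e (n + 2 ^ m * c + i) <;> simp
      refine ⟨n, 2 ^ m + 2 ^ m, by positivity, fun k hk => ?_⟩
      rw [← add_assoc, half _ (le_trans hk (Nat.le_add_right _ _)), half _ hk]
      simp

lemma evPer_countable : {d : ℕ → ℕ | EvPer d}.Countable := by
  have : {d : ℕ → ℕ | EvPer d} ⊆ ⋃ n : ℕ, ⋃ p : ℕ,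
      {d : ℕ → ℕ | 0 < p ∧ ∀ k, n ≤ k → d (k + p) = d k} := by
    rintro d ⟨n, p, h⟩
    simp only [mem_iUnion]
    exact ⟨n, p, h⟩
  refine Countable.mono this (countable_iUnion fun n => countable_iUnion fun p => ?_)
  apply Set.MapsTo.countable_of_injOn (f := fun d : ℕ → ℕ => (fun i : Fin (n + p) => d i))
    (t := univ) (fun _ _ => mem_univ _) _ countable_univ
  rintro d ⟨hp, h1⟩ d' ⟨-, h2⟩ heq
  have heq : ∀ i < n + p, d i = d' i := fun i hi => congrFun heq ⟨i, hi⟩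
  ext k
  induction k using Nat.strong_induction_on with
  | _ k ih =>
    by_cases hk : k < n + p
    · exact heq k hk
    · have a1 := h1 (k - p) (by omega)
      have a2 := h2 (k - p) (by omega)
      rw [show k - p + p = k by omega] at a1 a2
      rw [a1, a2, ih (k - p) (by omega)]

/-- `e` is a concatenation of Thue-Morse blocks of length `2^m` -/
def IsBlk (θ : ℕ → Bool) (m : ℕ) (e : ℕ → Bool) : Prop :=
  ∃ u : ℕ → Bool, ∀ a i, i < 2 ^ m → e (2 ^ m * a + i) = (u a == θ i)

lemma blk_not_Llt {θ : ℕ → Bool} (h : IsTM θ) (m : ℕ) : ∀ e : ℕ → Bool, IsBlk θ m e →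
    ∀ n, ¬ Llt (2 ^ m) (nrm e n) θ := by
  induction m with
  | zero =>
    rintro e - n ⟨j, hj, h1, h2, h3⟩
    have : j = 0 := by simpa using hj
    subst this
    simp [nrm] at h2
  | succ m ih =>
    rintro e ⟨u, hu⟩ n
    have hb : IsBlk θ m (fun k => e (2 * k)) := by
      refine ⟨u, fun a i hi => ?_⟩
      simp only
      rw [show 2 * (2 ^ m * a + i) = 2 ^ (m + 1) * a + 2 * i by ring, hu a _ (by rw [pow_succ]; omega),
        (h.even_odd i).1]
    have ho : ∀ k, e (2 * k + 1) = !(e (2 * k)) := by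
      intro k
      have hp : 0 < 2 ^ m := by positivity
      have := Nat.div_add_mod k (2 ^ m)
      have hlt := Nat.mod_lt k hp
      generalize k / 2 ^ m = a at *
      generalize k % 2 ^ m = i at *
      subst this
      rw [show 2 * (2 ^ m * a + i) + 1 = 2 ^ (m + 1) * a + (2 * i + 1) by ring,
        show 2 * (2 ^ m * a + i) = 2 ^ (m + 1) * a + 2 * i by ring, hu a _ (by rw [pow_succ]; omega),
        hu a _ (by rw [pow_succ]; omega), (h.even_odd i).1, (h.even_odd i).2]
      cases u a <;> cases θ i <;> rfl
    rintro ⟨j, hj, h1, h2, h3⟩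
    rw [pow_succ] at hj
    obtain ⟨k, rfl | rfl⟩ : ∃ k, n = 2 * k ∨ n = 2 * k + 1 := ⟨n / 2, by omega⟩
    · have n1 : ∀ i, nrm e (2 * k) (2 * i) = nrm (fun k => e (2 * k)) k i := by
        intro i; simp only [nrm]; rw [mul_add]
      have n2 : ∀ i, nrm e (2 * k) (2 * i + 1) = !(nrm (fun k => e (2 * k)) k i) := by
        intro i; simp only [nrm]; rw [← add_assoc, ← mul_add, ho]
        cases e (2 * (k + i)) <;> cases e (2 * k) <;> rfl
      obtain ⟨t, rfl | rfl⟩ : ∃ t, j = 2 * t ∨ j = 2 * t + 1 := ⟨j / 2, by omega⟩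
      · refine ih _ hb k ⟨t, by omega, fun i hi => ?_, ?_, ?_⟩
        · rw [← n1, ← (h.even_odd i).1]; exact h1 _ (by omega)
        · rw [← n1, h2]
        · rw [← (h.even_odd t).1, h3]
      · have := h1 (2 * t) (by omega)
        rw [n2] at h2
        rw [n1, (h.even_odd t).1] at this
        rw [(h.even_odd t).2, ← this, h2] at h3
        simp at h3
    · have t0 := h.1
      have t1 : θ 1 = false := by simpa [t0] using (h.even_odd 0).2
      have t2 : θ 2 = false := by simpa [t1] using (h.even_odd 1).1
      have m0 : nrm e (2 * k + 1) 0 = true := by simp [nrm]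
      have m1 : nrm e (2 * k + 1) 1 = (e (2 * (k + 1)) == !(e (2 * k))) := by
        simp only [nrm]; rw [ho]; rfl
      have m2 : nrm e (2 * k + 1) 2 = (e (2 * (k + 1)) == (e (2 * k))) := by
        simp only [nrm]; rw [ho, show 2 * k + 1 + 2 = 2 * (k + 1) + 1 by ring, ho]
        cases e (2 * (k + 1)) <;> cases e (2 * k) <;> rfl
      have j0 : j ≠ 0 := by rintro rfl; rw [m0] at h2; simp at h2
      have j1 : j ≠ 1 := by rintro rfl; rw [t1] at h3; simp at h3
      have j2 : j ≠ 2 := by rintro rfl; rw [t2] at h3; simp at h3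
      have a1 := h1 1 (by omega)
      have a2 := h1 2 (by omega)
      rw [m1, t1] at a1
      rw [m2, t2] at a2
      revert a1 a2
      cases e (2 * (k + 1)) <;> cases e (2 * k) <;> simp

/-- the uncountable family -/
def fam (θ u : ℕ → Bool) (p : ℕ) : Bool := u (Nat.log 2 p) == θ (p - 2 ^ Nat.log 2 p)

lemma fam_pow {θ : ℕ → Bool} (h : IsTM θ) (u : ℕ → Bool) (n : ℕ) : fam θ u (2 ^ n) = u n := by
  unfold fam
  rw [Nat.log_pow (by norm_num)]
  simp [h.1]

lemma fam_blk {θ : ℕ → Bool} (h : IsTM θ) (u : ℕ → Bool) (m : ℕ) :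
    IsBlk θ m (fun i => fam θ u (2 ^ m + i)) := by
  refine ⟨fun a => u (m + Nat.log 2 (a + 1)) == θ (a + 1 - 2 ^ Nat.log 2 (a + 1)), fun a i hi => ?_⟩
  simp only [fam]
  have h1 : 2 ^ (Nat.log 2 (a + 1)) ≤ a + 1 := Nat.pow_log_le_self 2 (by omega)
  have h2 : a + 1 < 2 ^ (Nat.log 2 (a + 1) + 1) := Nat.lt_pow_succ_log_self (by norm_num) (a + 1)
  generalize Nat.log 2 (a + 1) = l at *
  obtain ⟨t, ht⟩ := Nat.exists_eq_add_of_le h1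
  have hp : 0 < 2 ^ m := by positivity
  have hlog : Nat.log 2 (2 ^ m + (2 ^ m * a + i)) = m + l := by
    rw [show 2 ^ m + (2 ^ m * a + i) = 2 ^ m * (a + 1) + i by ring]
    apply Nat.log_eq_of_pow_le_of_lt_pow
    · rw [pow_add]; nlinarith
    · rw [add_assoc, pow_add]; nlinarith
  rw [hlog]
  have : 2 ^ m + (2 ^ m * a + i) - 2 ^ (m + l) = 2 ^ m * t + i := by
    rw [show 2 ^ m + (2 ^ m * a + i) = 2 ^ m * (a + 1) + i by ring, ht, pow_add, mul_add]
    omega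
  rw [this, h.block m t i hi, show a + 1 - 2 ^ l = t by omega]
  cases u (m + l) <;> cases θ t <;> cases θ i <;> rfl


lemma meas_f (i : ℕ) : Measurable (f N ρ i) := by
  unfold f; fun_prop

lemma real_ss {μ : Measure ℝ} [IsProbabilityMeasure μ] (hss : IsSelfSimilar N ρ μ) {A : Set ℝ}
    (hA : MeasurableSet A) :
    μ.real A = (N:ℝ)⁻¹ * ∑ i ∈ Finset.range N, μ.real (f N ρ i ⁻¹' A) := by
  have h : μ A = ∑ i ∈ Finset.range N, (N : ℝ≥0∞)⁻¹ * μ (f N ρ i ⁻¹' A) := by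
    conv_lhs => rw [show μ = _ from hss]
    rw [Measure.finsetSum_apply]
    refine Finset.sum_congr rfl fun i _ => ?_
    rw [Measure.smul_apply, Measure.map_apply (meas_f i) hA, smul_eq_mul]
  rw [Measure.real, h, ENNReal.toReal_sum]
  · rw [Finset.mul_sum]
    refine Finset.sum_congr rfl fun i _ => ?_
    rw [ENNReal.toReal_mul, ENNReal.toReal_inv]; simp [Measure.real]
  · intro i hi
    have : N ≠ 0 := by rintro rfl; simp at hi
    apply ENNReal.mul_ne_top
    · simpa using this
    · exact measure_ne_top _ _

/-- the reflected measure -/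
lemma ss_refl (hN : 2 ≤ N) {μ : Measure ℝ} (hss : IsSelfSimilar N ρ μ) :
    IsSelfSimilar N ρ (μ.map (fun x => 1 - x)) := by
  have hm : Measurable (fun x : ℝ => 1 - x) := by fun_prop
  unfold IsSelfSimilar at *
  conv_lhs => rw [hss]
  rw [← Measure.mapₗ_apply_of_measurable hm, map_sum, ← Finset.sum_range_reflect]
  refine Finset.sum_congr rfl fun i hi => ?_
  rw [Measure.mapₗ_apply_of_measurable hm, Measure.map_smul, Measure.map_map hm (meas_f _), Measure.map_map (meas_f _) hm]
  congr 2
  ext x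
  simp only [Function.comp, f]
  have hi' : i < N := by simpa using hi
  rw [Nat.cast_sub (by omega), Nat.cast_sub (by omega)]
  have := R_mul (ρ := ρ) hN
  push_cast
  linear_combination -this

lemma null_out (hN : 2 ≤ N) (hρ0 : 0 < ρ) (hρ1 : ρ ≤ 1 / (N : ℝ) ^ 2) {μ : Measure ℝ}
    [IsProbabilityMeasure μ] (hss : IsSelfSimilar N ρ μ) (c : ℝ) (hc : 0 < c) :
    μ.real (Icc (-c) (1 + c))ᶜ = 0 := by
  have hr := rho_lt hN hρ1
  have hN0 : (0:ℝ) < N := by exact_mod_cast (by omega : 0 < N)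
  have stp : ∀ c : ℝ, 0 < c → μ.real (Icc (-c) (1 + c))ᶜ ≤ μ.real (Icc (-(c / ρ)) (1 + c / ρ))ᶜ := by
    intro c hc
    rw [real_ss hss measurableSet_Icc.compl]
    have : ∀ i ∈ Finset.range N, μ.real (f N ρ i ⁻¹' (Icc (-c) (1 + c))ᶜ) ≤
        μ.real (Icc (-(c / ρ)) (1 + c / ρ))ᶜ := by
      intro i hi
      refine measureReal_mono ?_
      intro x hx hx'
      apply hx
      have hi' : (i:ℝ) ≤ N - 1 := by
        have : i + 1 ≤ N := by simpa using hi
        have : ((i + 1 : ℕ):ℝ) ≤ N := by exact_mod_cast this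
        push_cast at this; linarith
      have hR := R_pos hN hρ1
      have e1 := R_mul (ρ := ρ) hN
      have e2 : (i:ℝ) * R N ρ ≤ 1 - ρ := by rw [← e1]; gcongr
      have e3 : 0 ≤ (i:ℝ) * R N ρ := by positivity
      obtain ⟨h1, h2⟩ := hx'
      have g1 := mul_le_mul_of_nonneg_left h1 hρ0.le
      have g2 := mul_le_mul_of_nonneg_left h2 hρ0.le
      rw [show ρ * -(c / ρ) = -c by field_simp] at g1
      rw [show ρ * (1 + c / ρ) = ρ + c by field_simp] at g2
      simp only [f]
      constructor <;> linarith
    calc _ ≤ (N:ℝ)⁻¹ * ∑ i ∈ Finset.range N, μ.real (Icc (-(c / ρ)) (1 + c / ρ))ᶜ := by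
          exact mul_le_mul_of_nonneg_left (Finset.sum_le_sum this) (by positivity)
      _ = _ := by simp; field_simp
  have it : ∀ n : ℕ, μ.real (Icc (-c) (1 + c))ᶜ ≤ μ.real (Icc (-(c / ρ ^ n)) (1 + c / ρ ^ n))ᶜ := by
    intro n
    induction n with
    | zero => simp
    | succ n ih =>
      refine ih.trans ((stp _ (by positivity)).trans (le_of_eq ?_))
      rw [pow_succ, div_div]
  have lim : Tendsto (fun n : ℕ => μ.real (Icc (-(c / ρ ^ n)) (1 + c / ρ ^ n))ᶜ) atTop (𝓝 0) := by
    have hlim : Tendsto (fun n : ℕ => c / ρ ^ n) atTop atTop := by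
      have := tendsto_pow_atTop_atTop_of_one_lt (r := ρ⁻¹) ((one_lt_inv₀ hρ0).2 (by linarith))
      have := this.const_mul_atTop hc
      refine this.congr fun n => ?_
      rw [inv_pow]; rfl
    have hmono : Monotone (fun n : ℕ => c / ρ ^ n) := by
      apply monotone_nat_of_le_succ
      intro n
      apply div_le_div_of_nonneg_left hc.le (by positivity)
      rw [pow_succ]
      have : 0 < ρ ^ n := by positivity
      nlinarith
    have := tendsto_measure_iInter_atTop (μ := μ)
      (s := fun n : ℕ => (Icc (-(c / ρ ^ n)) (1 + c / ρ ^ n))ᶜ)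
      (fun n => measurableSet_Icc.compl.nullMeasurableSet)
      (by
        intro a b hab
        apply compl_subset_compl.2
        have := hmono hab
        simp only at this
        apply Icc_subset_Icc <;> linarith)
      ⟨0, measure_ne_top _ _⟩
    have he : ⋂ n : ℕ, (Icc (-(c / ρ ^ n)) (1 + c / ρ ^ n))ᶜ = ∅ := by
      rw [← compl_iUnion, compl_empty_iff, eq_univ_iff_forall]
      intro x
      rw [mem_iUnion]
      obtain ⟨n, hn⟩ := (hlim.eventually_ge_atTop |x|).exists
      refine ⟨n, ?_, ?_⟩
      · have := neg_abs_le x; linarith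
      · have := le_abs_self x; linarith
    rw [he, measure_empty] at this
    have := (ENNReal.tendsto_toReal ENNReal.zero_ne_top).comp this
    simpa [Measure.real, Function.comp_def] using this
  exact le_antisymm (ge_of_tendsto' lim it) measureReal_nonneg

lemma null_neg (hN : 2 ≤ N) (hρ0 : 0 < ρ) (hρ1 : ρ ≤ 1 / (N : ℝ) ^ 2) {μ : Measure ℝ}
    [IsProbabilityMeasure μ] (hss : IsSelfSimilar N ρ μ) : μ.real (Icc (0:ℝ) 1)ᶜ = 0 := by
  rw [measureReal_eq_zero_iff]
  have : (Icc (0:ℝ) 1)ᶜ ⊆ ⋃ n : ℕ, (Icc (-(1 / ((n:ℝ) + 1))) (1 + 1 / ((n:ℝ) + 1)))ᶜ := by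
    intro x hx
    rw [← compl_iInter]
    intro hx'
    apply hx
    rw [mem_iInter] at hx'
    have l := tendsto_one_div_add_atTop_nhds_zero_nat (𝕜 := ℝ)
    constructor
    · have := le_of_tendsto' (l.neg) (fun n => (hx' n).1)
      simpa using this
    · have := ge_of_tendsto' (l.const_add 1) (fun n => (hx' n).2)
      simpa using this
  refine measure_mono_null this (measure_iUnion_null fun n => ?_)
  have := null_out hN hρ0 hρ1 hss (1 / ((n:ℝ) + 1)) (by positivity)
  rwa [measureReal_eq_zero_iff] at this

lemma pre_ball (hρ0 : 0 < ρ) (i : ℕ) (x r : ℝ) :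
    f N ρ i ⁻¹' (Ioo (x - r) (x + r)) =
      Ioo ((x - i * R N ρ) / ρ - r / ρ) ((x - i * R N ρ) / ρ + r / ρ) := by
  ext z
  simp only [mem_preimage, f, mem_Ioo]
  rw [← sub_div, ← add_div, div_lt_iff₀ hρ0, lt_div_iff₀ hρ0]
  constructor <;> rintro ⟨h1, h2⟩ <;> constructor <;> linarith

lemma ball_step (hN : 2 ≤ N) (hρ0 : 0 < ρ) (hρ1 : ρ ≤ 1 / (N : ℝ) ^ 2) {μ : Measure ℝ}
    [IsProbabilityMeasure μ] (hss : IsSelfSimilar N ρ μ) (k : ℕ) (hk : k < N) (y : ℝ)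
    (hy0 : 0 ≤ y) (hy1 : y ≤ 1) (r : ℝ) (hr : r ≤ ρ) :
    μ.real (Ioo (k * R N ρ + ρ * y - r) (k * R N ρ + ρ * y + r)) =
      (N:ℝ)⁻¹ * μ.real (Ioo (y - r / ρ) (y + r / ρ)) := by
  rw [real_ss hss measurableSet_Ioo]
  congr 1
  rw [Finset.sum_eq_single_of_mem k (by simpa using hk)]
  · rw [pre_ball hρ0]
    congr 3 <;> field_simp <;> ring
  · intro i hi hne
    rw [pre_ball hρ0]
    refine le_antisymm ?_ measureReal_nonneg
    rw [← null_neg hN hρ0 hρ1 hss]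
    refine measureReal_mono ?_
    have hR := R_ge hN hρ0 hρ1
    have hr' : r / ρ ≤ 1 := by rw [div_le_one hρ0]; exact hr
    have hR' : 3 ≤ R N ρ / ρ := by rw [le_div_iff₀ hρ0]; exact hR
    have e : (k * R N ρ + ρ * y - i * R N ρ) / ρ = y + ((k:ℝ) - i) * (R N ρ / ρ) := by
      field_simp; ring
    rw [e]
    intro z hz hz'
    obtain ⟨h1, h2⟩ := hz
    obtain ⟨h3, h4⟩ := hz'
    rcases lt_or_gt_of_ne hne with h | h
    · have : (i:ℝ) + 1 ≤ k := by exact_mod_cast h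
      nlinarith
    · have : (k:ℝ) + 1 ≤ i := by exact_mod_cast h
      nlinarith

lemma ball_iter (hN : 2 ≤ N) (hρ0 : 0 < ρ) (hρ1 : ρ ≤ 1 / (N : ℝ) ^ 2) {μ : Measure ℝ}
    [IsProbabilityMeasure μ] (hss : IsSelfSimilar N ρ μ) (n : ℕ) : ∀ (d : ℕ → ℕ)
    (_ : ∀ i, d i < N) (r : ℝ) (_ : r ≤ ρ ^ n),
    μ.real (Ioo (piMap N ρ d - r) (piMap N ρ d + r)) =
      (N:ℝ)⁻¹ ^ n * μ.real (Ioo (Tn N ρ d n - r / ρ ^ n) (Tn N ρ d n + r / ρ ^ n)) := by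
  have h4 := rho_lt hN hρ1
  induction n with
  | zero => intro d hd r hr; simp [Tn]
  | succ n ih =>
    intro d hd r hr
    rw [piMap_rec hρ0 h4 d hd, ball_step hN hρ0 hρ1 hss _ (hd 0) _ (piMap_nonneg hN hρ0 hρ1 _)
      (piMap_le hN hρ0 hρ1 _ (fun i => hd _)), ih (fun i => d (1 + i)) (fun i => hd _)]
    · have : Tn N ρ (fun i => d (1 + i)) n = Tn N ρ d (n + 1) := by
        unfold Tn; congr 1; ext i; simp only; rw [show 1 + (n + i) = n + 1 + i by ring]
      rw [this, pow_succ ρ, pow_succ (N:ℝ)⁻¹, div_div, mul_comm (ρ ^ n) ρ]; ring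
    · rw [div_le_iff₀ hρ0, ← pow_succ]; exact hr
    · refine hr.trans ?_
      rw [pow_succ]
      have : ρ ^ n ≤ 1 := pow_le_one₀ hρ0.le (by linarith)
      nlinarith

lemma ball_lower (hN : 2 ≤ N) (hρ0 : 0 < ρ) (hρ1 : ρ ≤ 1 / (N : ℝ) ^ 2) {μ : Measure ℝ}
    [IsProbabilityMeasure μ] (hss : IsSelfSimilar N ρ μ) (n : ℕ) : ∀ (d : ℕ → ℕ)
    (_ : ∀ i, d i < N) (c : ℝ) (_ : gam (Tn N ρ d n) < c),
    (N:ℝ)⁻¹ ^ n ≤ μ.real (Ioo (piMap N ρ d - ρ ^ n * c) (piMap N ρ d + ρ ^ n * c)) := by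
  have h4 := rho_lt hN hρ1
  induction n with
  | zero =>
    intro d hd c hc
    simp only [Tn, zero_add] at hc
    have h1 : piMap N ρ d < c := lt_of_le_of_lt (le_max_left _ _) hc
    have h2 : 1 - piMap N ρ d < c := lt_of_le_of_lt (le_max_right _ _) hc
    have h3 : μ.real (Icc (0:ℝ) 1) = 1 := by
      have a := null_neg hN hρ0 hρ1 hss
      have b := probReal_compl_eq_one_sub (μ := μ) (measurableSet_Icc (a := (0:ℝ)) (b := 1))
      linarith
    simp only [pow_zero, one_mul]
    rw [← h3]
    refine measureReal_mono ?_
    rintro z ⟨g1, g2⟩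
    constructor <;> linarith
  | succ n ih =>
    intro d hd c hc
    have hT : Tn N ρ (fun i => d (1 + i)) n = Tn N ρ d (n + 1) := by
      unfold Tn; congr 1; ext i; simp only; rw [show 1 + (n + i) = n + 1 + i by ring]
    have := ih (fun i => d (1 + i)) (fun i => hd _) c (by rwa [hT])
    rw [real_ss hss measurableSet_Ioo, pow_succ, mul_comm]
    gcongr
    refine this.trans (le_trans ?_ (Finset.single_le_sum (f := fun i => μ.real (f N ρ i ⁻¹'
      (Ioo (piMap N ρ d - ρ ^ (n+1) * c) (piMap N ρ d + ρ ^ (n+1) * c))))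
      (fun i _ => measureReal_nonneg) (Finset.mem_range.2 (hd 0))))
    rw [pre_ball hρ0, piMap_rec hρ0 h4 d hd]
    apply le_of_eq
    congr 3 <;> field_simp <;> ring


lemma H_nonpos (hN : 2 ≤ N) (hρ0 : 0 < ρ) (hρ1 : ρ ≤ 1 / (N : ℝ) ^ 2) {μ : Measure ℝ}
    [IsProbabilityMeasure μ] (hss : IsSelfSimilar N ρ μ) (t : ℝ) (ht : t ≤ 0) :
    μ.real (Iio t) = 0 := by
  refine le_antisymm ?_ measureReal_nonneg
  rw [← null_neg hN hρ0 hρ1 hss]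
  refine measureReal_mono ?_
  rintro z hz ⟨h1, -⟩
  have : z < t := hz
  linarith

lemma H_rec (hN : 2 ≤ N) (hρ0 : 0 < ρ) (hρ1 : ρ ≤ 1 / (N : ℝ) ^ 2) {μ : Measure ℝ}
    [IsProbabilityMeasure μ] (hss : IsSelfSimilar N ρ μ) (t : ℝ) (j : ℕ) (hj : j < N)
    (ht : t ≤ ((j:ℝ) + 1) * R N ρ) :
    μ.real (Iio t) ≤ (j + μ.real (Iio ((t - j * R N ρ) / ρ))) / N := by
  rw [real_ss hss measurableSet_Iio]
  have hpre : ∀ i, f N ρ i ⁻¹' (Iio t) = Iio ((t - i * R N ρ) / ρ) := by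
    intro i; ext z
    simp only [mem_preimage, f, mem_Iio]
    rw [lt_div_iff₀ hρ0]
    constructor <;> intro h <;> linarith
  simp_rw [hpre]
  have hR := R_pos hN hρ1
  rw [div_eq_inv_mul]
  gcongr
  have hsplit : N = (j + 1) + (N - (j + 1)) := by omega
  rw [hsplit, Finset.sum_range_add, Finset.sum_range_succ]
  have z : ∑ x ∈ Finset.range (N - (j + 1)), μ.real (Iio ((t - ((j + 1 + x : ℕ):ℝ) * R (j + 1 + (N - (j + 1))) ρ) / ρ)) = 0 := by
    apply Finset.sum_eq_zero
    intro i _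
    rw [← hsplit]
    apply H_nonpos hN hρ0 hρ1 hss
    apply div_nonpos_of_nonpos_of_nonneg _ hρ0.le
    push_cast
    nlinarith [mul_nonneg (Nat.cast_nonneg (α := ℝ) i) hR.le]
  have z2 : ∑ x ∈ Finset.range j, μ.real (Iio ((t - (x:ℝ) * R N ρ) / ρ)) ≤ j := by
    calc _ ≤ ∑ x ∈ Finset.range j, (1:ℝ) := Finset.sum_le_sum fun i _ => measureReal_le_one
      _ = _ := by simp
  rw [z, ← hsplit]
  linarith

lemma exists_j (hN : 2 ≤ N) (hρ0 : 0 < ρ) (hρ1 : ρ ≤ 1 / (N : ℝ) ^ 2) (t : ℝ) (h0 : 0 ≤ t)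
    (h1 : t ≤ 1) : ∃ j < N, j * R N ρ ≤ t ∧ t ≤ ((j:ℝ) + 1) * R N ρ := by
  have hR := R_pos hN hρ1
  have hR' := R_ge hN hρ0 hρ1
  have e1 := R_mul (ρ := ρ) hN
  have a1 : (⌊t / R N ρ⌋₊ : ℝ) ≤ t / R N ρ := Nat.floor_le (by positivity)
  have a2 := (Nat.lt_floor_add_one (t / R N ρ)).le
  rw [le_div_iff₀ hR] at a1
  rw [div_le_iff₀ hR] at a2
  refine ⟨⌊t / R N ρ⌋₊, ?_, a1, a2⟩
  have : (⌊t / R N ρ⌋₊ : ℝ) < N := by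
    by_contra h
    push Not at h
    nlinarith
  exact_mod_cast this

lemma H_lin (hN : 2 ≤ N) (hρ0 : 0 < ρ) (hρ1 : ρ ≤ 1 / (N : ℝ) ^ 2) {μ : Measure ℝ}
    [IsProbabilityMeasure μ] (hss : IsSelfSimilar N ρ μ) (u : ℝ) (hu0 : 0 ≤ u) (hu1 : u ≤ 1) :
    μ.real (Iio u) ≤ (1 + u) / 2 := by
  have hN2 : (2:ℝ) ≤ N := by exact_mod_cast hN
  have hR := R_pos hN hρ1
  have e1 := R_mul (ρ := ρ) hN
  have hm := rho_mul hN hρ1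
  have hNρ : ρ * N ≤ 1 := by nlinarith [mul_pos hρ0 (by linarith : (0:ℝ) < N)]
  have key : ∀ n : ℕ, ∀ u : ℝ, 0 ≤ u → u ≤ 1 → μ.real (Iio u) ≤ (1 + u) / 2 + (1/2) ^ n := by
    intro n
    induction n with
    | zero => intro u hu _; have := measureReal_le_one (μ := μ) (s := Iio u); simp; linarith
    | succ n ih =>
      intro u hu0 hu1
      obtain ⟨j, hj, j1, j2⟩ := exists_j hN hρ0 hρ1 u hu0 hu1
      have hrec := H_rec hN hρ0 hρ1 hss u j hj j2
      have hpow : (0:ℝ) < (1/2) ^ n := by positivity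
      by_cases hlast : j + 1 = N
      · have hjr : (j:ℝ) = N - 1 := by rw [← hlast]; push_cast; ring
        have hi : (u - j * R N ρ) / ρ = 1 - (1 - u) / ρ := by
          rw [hjr, e1]; field_simp; ring
        have := ih ((u - j * R N ρ) / ρ) (div_nonneg (by linarith) hρ0.le)
          (by rw [hi]; have : 0 ≤ (1 - u) / ρ := div_nonneg (by linarith) hρ0.le
              linarith)
        refine hrec.trans ?_
        rw [div_le_iff₀ (by linarith)]
        have q : (1 - u) * N ≤ (1 - u) / ρ := by
          rw [le_div_iff₀ hρ0]; nlinarith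
        rw [hi] at this ⊢
        rw [hjr, pow_succ]
        nlinarith
      · have hjN : (j:ℝ) + 2 ≤ N := by exact_mod_cast (by omega : j + 2 ≤ N)
        have : μ.real (Iio u) ≤ (j + 1) / N := hrec.trans (by
          gcongr; exact measureReal_le_one)
        have h2 : ((j:ℝ) + 1) / N ≤ (1 + j * R N ρ) / 2 := by
          rw [div_le_div_iff₀ (by linarith) (by norm_num)]
          have hj0 : (0:ℝ) ≤ j := Nat.cast_nonneg j
          have hB : 0 ≤ ((1 + R N ρ * j) * N - 2 * (j + 1)) := by
            have hk : (0:ℝ) ≤ N - 2 - j := by linarith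
            have hA : ((1 + R N ρ * j) * N - 2 * (j + 1)) * (N - 1)
                = (N - 1) * (N - 2 - j) + j * ((1 - ρ * N)) := by
              have : R N ρ * (N - 1) = 1 - ρ := by linarith
              linear_combination (N * j : ℝ) * this
            have hB : 0 ≤ ((1 + R N ρ * j) * N - 2 * (j + 1)) * ((N:ℝ) - 1) := by
              rw [hA]
              have : 0 ≤ ((N:ℝ) - 1) * (N - 2 - j) := mul_nonneg (by linarith) hk
              have : 0 ≤ (j:ℝ) * (1 - ρ * N) := mul_nonneg hj0 (by linarith)
              linarith
            exact nonneg_of_mul_nonneg_left hB (by linarith)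
          nlinarith
        have : (0:ℝ) < (1/2) ^ (n+1) := by positivity
        linarith
  have lim : Tendsto (fun n : ℕ => (1 + u) / 2 + (1/2:ℝ) ^ n) atTop (𝓝 ((1 + u) / 2 + 0)) :=
    (_root_.tendsto_pow_atTop_nhds_zero_of_lt_one (by norm_num) (by norm_num)).const_add _
  rw [add_zero] at lim
  exact ge_of_tendsto' lim (fun n => key n u hu0 hu1)

lemma ineq_E1 (n j : ℝ) (h2 : 2 ≤ n) (hj : 1 ≤ j) (hjn : j + 1 ≤ n) :
    (j + 1 / 2) ^ 2 * (n ^ 2 - 1) ≤ n ^ 2 * (j * (n + 1) - 1) := by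
  have a1 : 0 ≤ (j - 1) * (n - (j + 1)) := mul_nonneg (by linarith) (by linarith)
  have a2 : 0 ≤ n ^ 2 - 1 := by nlinarith
  have a3 := mul_nonneg a1 a2
  have a4 : 0 ≤ n ^ 3 - 2.25 * n ^ 2 + 2.25 := by
    nlinarith [mul_nonneg (sq_nonneg n) (by linarith : 0 ≤ n - 2), sq_nonneg (n - 2)]
  have a5 : 0 ≤ n ^ 3 - 1.25 * n ^ 2 - n + 0.25 := by
    nlinarith [mul_nonneg (sq_nonneg n) (by linarith : 0 ≤ n - 2), sq_nonneg (n - 2)]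
  rcases eq_or_lt_of_le h2 with h2 | h2
  · have : j = 1 := by linarith
    rw [← h2, this]; norm_num
  · have b1 : 0 ≤ (j - 1) * (n ^ 3 - 1.25 * n ^ 2 - n + 0.25) := mul_nonneg (by linarith) a5
    have b2 : 0 ≤ (n - (j + 1)) * (n ^ 3 - 2.25 * n ^ 2 + 2.25) := mul_nonneg (by linarith) a4
    have b3 := mul_nonneg a3 (by linarith : 0 ≤ n - 2)
    have e : (n - 2) * (n ^ 2 * (j * (n + 1) - 1) - (j + 1 / 2) ^ 2 * (n ^ 2 - 1)) =
        (j - 1) * (n ^ 3 - 1.25 * n ^ 2 - n + 0.25) + (n - (j + 1)) * (n ^ 3 - 2.25 * n ^ 2 + 2.25)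
        + (j - 1) * (n - (j + 1)) * (n ^ 2 - 1) * (n - 2) := by ring
    have : 0 ≤ (n - 2) * (n ^ 2 * (j * (n + 1) - 1) - (j + 1 / 2) ^ 2 * (n ^ 2 - 1)) := by
      rw [e]; linarith
    have := nonneg_of_mul_nonneg_right this (by linarith)
    linarith

lemma H_sq (hN : 2 ≤ N) (hρ0 : 0 < ρ) (hρ1 : ρ ≤ 1 / (N : ℝ) ^ 2) {μ : Measure ℝ}
    [IsProbabilityMeasure μ] (hss : IsSelfSimilar N ρ μ) (t : ℝ) (ht0 : R N ρ < t) (ht1 : t ≤ 1) :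
    μ.real (Iio t) ^ 2 ≤ (t - ρ) / (1 - ρ) := by
  have hN2 : (2:ℝ) ≤ N := by exact_mod_cast hN
  have hR := R_pos hN hρ1
  have e1 := R_mul (ρ := ρ) hN
  have hm := rho_mul hN hρ1
  have h4 := rho_lt hN hρ1
  obtain ⟨j, hj, j1, j2⟩ := exists_j hN hρ0 hρ1 t (by linarith) ht1
  have hrec := H_rec hN hρ0 hρ1 hss t j hj j2
  have hj1 : (1:ℝ) ≤ j := by
    by_contra h
    have : j = 0 := by
      by_contra h'
      exact h (by exact_mod_cast (by omega : 1 ≤ j))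
    subst this
    simp at j2; linarith
  have hjN : (j:ℝ) + 1 ≤ N := by exact_mod_cast hj
  -- endpoint inequalities
  have E0 : ((j:ℝ) + 1) ^ 2 * (N - 1) ≤ j * N ^ 2 := by
    nlinarith [mul_nonneg (by linarith : (0:ℝ) ≤ N - (j + 1)) (by nlinarith : (0:ℝ) ≤ j * N - (j + 1))]
  have Hnn : 0 ≤ μ.real (Iio t) := measureReal_nonneg
  have hjR : (j:ℝ) * R N ρ / (1 - ρ) = j / (N - 1) := by
    rw [← e1]; field_simp
  have D0 : (((j:ℝ) + 1) / N) ^ 2 ≤ j / (N - 1) := by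
    rw [div_pow, div_le_div_iff₀ (by positivity) (by linarith)]; exact E0
  have hd : (0:ℝ) < 1 - ρ := by linarith
  by_cases hcase : j * R N ρ + ρ ≤ t
  · calc μ.real (Iio t) ^ 2 ≤ (((j:ℝ) + 1) / N) ^ 2 := by
          apply pow_le_pow_left₀ Hnn
          refine hrec.trans ?_
          gcongr; exact measureReal_le_one
      _ ≤ (j:ℝ) / (N - 1) := D0
      _ = (j:ℝ) * R N ρ / (1 - ρ) := hjR.symm
      _ ≤ _ := by gcongr; linarith
  · push Not at hcase
    obtain ⟨v, hv⟩ : ∃ v, v = 1 - (t - j * R N ρ) / ρ := ⟨_, rfl⟩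
    have hu : (t - j * R N ρ) / ρ = 1 - v := by linarith
    have hv1 : v ≤ 1 := by
      have : 0 ≤ (t - j * R N ρ) / ρ := div_nonneg (by linarith) hρ0.le
      linarith
    have hv0 : 0 ≤ v := by
      have : (t - j * R N ρ) / ρ ≤ 1 := by rw [div_le_one hρ0]; linarith
      linarith
    have hlin := H_lin hN hρ0 hρ1 hss (1 - v) (by linarith) (by linarith)
    rw [hu] at hrec
    have ht : t = j * R N ρ + ρ * (1 - v) := by rw [← hu]; field_simp; ring
    have E1 := ineq_E1 N j hN2 hj1 hjN
    have hN1 : (0:ℝ) < N ^ 2 - 1 := by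
      have : (2:ℝ) ^ 2 ≤ N ^ 2 := pow_le_pow_left₀ (by norm_num) hN2 2
      linarith
    have D1 : (((j:ℝ) + 1 / 2) / N) ^ 2 ≤ j / (N - 1) - 1 / (N ^ 2 - 1) := by
      have : (j:ℝ) / (N - 1) - 1 / (N ^ 2 - 1) = (j * (N + 1) - 1) / (N ^ 2 - 1) := by
        have : (N:ℝ) - 1 ≠ 0 := by linarith
        rw [show (N:ℝ) ^ 2 - 1 = (N - 1) * (N + 1) by ring]
        field_simp
      rw [this, div_pow, div_le_div_iff₀ (by positivity) hN1]
      linarith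
    have hρN : ρ / (1 - ρ) ≤ 1 / ((N:ℝ) ^ 2 - 1) := by
      rw [div_le_div_iff₀ hd hN1]; linarith
    have hRHS : (t - ρ) / (1 - ρ) = j / (N - 1) - v * (ρ / (1 - ρ)) := by
      rw [← hjR, ht]; field_simp; ring
    rw [hRHS]
    calc μ.real (Iio t) ^ 2 ≤ ((1 - v) * (((j:ℝ) + 1) / N) + v * ((j + 1 / 2) / N)) ^ 2 := by
          apply pow_le_pow_left₀ Hnn
          refine hrec.trans ?_
          rw [← mul_div_assoc, ← mul_div_assoc, ← add_div]
          refine div_le_div_of_nonneg_right ?_ (by linarith)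
          linarith
      _ ≤ (1 - v) * (((j:ℝ) + 1) / N) ^ 2 + v * ((j + 1 / 2) / N) ^ 2 := by
          nlinarith [mul_nonneg (mul_nonneg hv0 (by linarith : 0 ≤ 1 - v))
            (sq_nonneg (((j:ℝ) + 1) / N - (j + 1 / 2) / N))]
      _ ≤ (1 - v) * (j / (N - 1)) + v * (j / (N - 1) - 1 / (N ^ 2 - 1)) := by
          gcongr
      _ ≤ _ := by nlinarith [mul_le_mul_of_nonneg_left hρN hv0]


lemma s_facts (hN : 2 ≤ N) (hρ0 : 0 < ρ) (hρ1 : ρ ≤ 1 / (N : ℝ) ^ 2) {s : ℝ}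
    (hs : s = -Real.log N / Real.log ρ) : 0 < s ∧ s ≤ 1 / 2 ∧ ρ ^ s = (N:ℝ)⁻¹ := by
  have hN2 : (2:ℝ) ≤ N := by exact_mod_cast hN
  have h4 := rho_lt hN hρ1
  have hl : Real.log ρ < 0 := Real.log_neg hρ0 (by linarith)
  have hlN : 0 < Real.log N := Real.log_pos (by linarith)
  have h2 : Real.log ρ ≤ -(2 * Real.log N) := by
    have := Real.log_le_log hρ0 hρ1
    rw [one_div, Real.log_inv, Real.log_pow] at this
    simpa using this
  refine ⟨?_, ?_, ?_⟩
  · rw [hs]; exact div_pos_of_neg_of_neg (by linarith) hl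
  · rw [hs, div_le_iff_of_neg hl]; linarith
  · rw [Real.rpow_def_of_pos hρ0, hs, mul_div_cancel₀ _ hl.ne, Real.exp_neg,
      Real.exp_log (by linarith)]

lemma core1 (hN : 2 ≤ N) (hρ0 : 0 < ρ) (hρ1 : ρ ≤ 1 / (N : ℝ) ^ 2) {s : ℝ}
    (hs : s = -Real.log N / Real.log ρ) {μ : Measure ℝ}
    [IsProbabilityMeasure μ] (hss : IsSelfSimilar N ρ μ) (y r g : ℝ) (hy0 : 0 ≤ y) (hy1 : y ≤ ρ)
    (hr : ρ < r) (hg0 : 0 < g) (hg : g ≤ 1 - y) : μ.real (Iio (y + r)) ≤ (r / g) ^ s := by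
  obtain ⟨s0, s1, s2⟩ := s_facts hN hρ0 hρ1 hs
  have h4 := rho_lt hN hρ1
  have hN2 : (2:ℝ) ≤ N := by exact_mod_cast hN
  rcases le_or_gt g r with hgr | hgr
  · refine measureReal_le_one.trans (Real.one_le_rpow ?_ s0.le)
    rw [one_le_div hg0]; exact hgr
  rcases le_or_gt (y + r) (R N ρ) with hR | hR
  · have := H_rec hN hρ0 hρ1 hss (y + r) 0 (by omega) (by simpa using hR)
    refine this.trans ?_
    have h1 := measureReal_le_one (μ := μ) (s := Iio ((y + r - ((0:ℕ):ℝ) * R N ρ) / ρ))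
    calc _ ≤ (N:ℝ)⁻¹ := by
          rw [inv_eq_one_div]; gcongr; push_cast at *; linarith
      _ = ρ ^ s := s2.symm
      _ ≤ _ := by
        apply Real.rpow_le_rpow hρ0.le _ s0.le
        rw [le_div_iff₀ hg0]; nlinarith
  · have := H_sq hN hρ0 hρ1 hss (y + r) hR (by linarith)
    have hRρ := R_ge hN hρ0 hρ1
    have hd : 0 < 1 - ρ := by linarith
    have q0 : 0 < (y + r - ρ) / (1 - ρ) := div_pos (by linarith) hd
    have q1 : (y + r - ρ) / (1 - ρ) ≤ 1 := by rw [div_le_one hd]; linarith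
    calc _ ≤ √((y + r - ρ) / (1 - ρ)) := Real.le_sqrt_of_sq_le this
      _ = ((y + r - ρ) / (1 - ρ)) ^ (1 / 2 : ℝ) := Real.sqrt_eq_rpow _
      _ ≤ ((y + r - ρ) / (1 - ρ)) ^ s := Real.rpow_le_rpow_of_exponent_ge q0 q1 s1
      _ ≤ _ := by
        apply Real.rpow_le_rpow q0.le _ s0.le
        calc (y + r - ρ) / (1 - ρ) ≤ r / (1 - y) := by
              rw [div_le_div_iff₀ hd (by linarith)]; nlinarith
          _ ≤ r / g := by gcongr; linarith

lemma core2 (hN : 2 ≤ N) (hρ0 : 0 < ρ) (hρ1 : ρ ≤ 1 / (N : ℝ) ^ 2) {s : ℝ}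
    (hs : s = -Real.log N / Real.log ρ) {μ : Measure ℝ}
    [IsProbabilityMeasure μ] (hss : IsSelfSimilar N ρ μ) (y r g : ℝ) (hy0 : 0 ≤ y) (hy1 : y ≤ 1)
    (hy : y ≤ ρ ∨ 1 - ρ ≤ y)
    (hr : ρ < r) (hg0 : 0 < g) (hg : g ≤ gam y) :
    μ.real (Ioo (y - r) (y + r)) ≤ (r / g) ^ s := by
  have h4 := rho_lt hN hρ1
  rcases hy with hy | hy
  · have : gam y = 1 - y := max_eq_right (by linarith)
    refine le_trans (measureReal_mono ?_) (core1 hN hρ0 hρ1 hs hss y r g hy0 hy hr hg0 (this ▸ hg))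
    exact fun z hz => hz.2
  · have : gam y = y := max_eq_left (by linarith)
    have hm : Measurable (fun x : ℝ => 1 - x) := by fun_prop
    have : IsProbabilityMeasure (μ.map (fun x => 1 - x)) :=
      Measure.isProbabilityMeasure_map hm.aemeasurable
    have key := core1 hN hρ0 hρ1 hs (ss_refl hN hss) (1 - y) r g (by linarith) (by linarith) hr hg0
      (by linarith)
    refine le_trans ?_ key
    rw [map_measureReal_apply hm measurableSet_Iio]
    refine measureReal_mono ?_
    intro z hz
    have := hz.1
    simp only [mem_preimage, mem_Iio]
    linarith

lemma pow_rpow (hN : 2 ≤ N) (hρ0 : 0 < ρ) (hρ1 : ρ ≤ 1 / (N : ℝ) ^ 2) {s : ℝ}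
    (hs : s = -Real.log N / Real.log ρ) (n : ℕ) (c : ℝ) (hc : 0 ≤ c) :
    (2 * (ρ ^ n * c)) ^ s = (N:ℝ)⁻¹ ^ n * (2 * c) ^ s := by
  obtain ⟨s0, s1, s2⟩ := s_facts hN hρ0 hρ1 hs
  rw [show 2 * (ρ ^ n * c) = ρ ^ n * (2 * c) by ring, Real.mul_rpow (by positivity) (by positivity),
    ← s2, ← Real.rpow_natCast, ← Real.rpow_natCast, ← Real.rpow_mul hρ0.le, ← Real.rpow_mul hρ0.le,
    mul_comm s]

lemma dens_upper (hN : 2 ≤ N) (hρ0 : 0 < ρ) (hρ1 : ρ ≤ 1 / (N : ℝ) ^ 2) {s : ℝ}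
    (hs : s = -Real.log N / Real.log ρ) {μ : Measure ℝ}
    [IsProbabilityMeasure μ] (hss : IsSelfSimilar N ρ μ) (e : ℕ → Bool) (n0 : ℕ) (g : ℝ) (hg0 : 0 < g)
    (hg : ∀ n, n0 ≤ n → g ≤ gam (val N ρ (fun i => e (n + i)))) :
    upperDensity μ s (val N ρ e) ≤ (2 * g) ^ (-s) := by
  obtain ⟨s0, s1, s2⟩ := s_facts hN hρ0 hρ1 hs
  have h4 := rho_lt hN hρ1
  have hN0 : (0:ℝ) < N := by exact_mod_cast (by omega : 0 < N)
  unfold upperDensity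
  refine limsup_le_of_le ?_ ?_
  · apply Filter.IsCoboundedUnder.of_frequently_ge (a := 0)
    apply Filter.Eventually.frequently
    filter_upwards [self_mem_nhdsWithin] with r hr
    have : (0:ℝ) < r := hr
    positivity
  · have hmem : Ioo (0:ℝ) (ρ ^ n0) ∈ 𝓝[>] (0:ℝ) := Ioo_mem_nhdsGT (by positivity)
    filter_upwards [hmem] with r hr
    obtain ⟨hr0, hr1⟩ := hr
    have hr1' : r ≤ 1 := hr1.le.trans (pow_le_one₀ hρ0.le (by linarith))
    obtain ⟨n, hn1, hn2⟩ := exists_nat_pow_near_of_lt_one hr0 hr1' hρ0 (by linarith)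
    have hnn : n0 ≤ n := by
      have : n0 < n + 1 := (pow_lt_pow_iff_right_of_lt_one₀ hρ0 (by linarith)).1 (hn1.trans hr1)
      omega
    have hpn : 0 < ρ ^ n := by positivity
    obtain ⟨r', hr'⟩ : ∃ r', r' = r / ρ ^ n := ⟨_, rfl⟩
    have hrr : r = ρ ^ n * r' := by rw [hr']; field_simp
    have hrρ : ρ < r' := by rw [hr', lt_div_iff₀ hpn, ← pow_succ']; exact hn1
    have hr'0 : 0 < r' := hρ0.trans hrρ
    have it := ball_iter hN hρ0 hρ1 hss n (dig N e) (dig_lt hN e) r hn2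
    rw [← hr'] at it
    have hT : Tn N ρ (dig N e) n = val N ρ (fun i => e (n + i)) := rfl
    have hrec := val_rec hN hρ0 hρ1 (fun i => e (n + i))
    have v1 := val_le hN hρ0 hρ1 (fun i => e (n + (1 + i)))
    have v2 := val_nonneg hN hρ0 hρ1 (fun i => e (n + (1 + i)))
    have c2 := core2 hN hρ0 hρ1 hs hss (val N ρ (fun i => e (n + i))) r' g
      (val_nonneg hN hρ0 hρ1 _) (val_le hN hρ0 hρ1 _) (by
        rw [hrec]
        split
        · right; nlinarith
        · left; nlinarith) hrρ hg0 (hg n hnn)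
    rw [hT] at it
    change μ.real (Ioo (piMap N ρ (dig N e) - r) (piMap N ρ (dig N e) + r)) / _ ≤ _
    rw [it, hrr, pow_rpow hN hρ0 hρ1 hs n r' hr'0.le]
    have hNn : 0 < (N:ℝ)⁻¹ ^ n := by positivity
    rw [mul_div_mul_left _ _ hNn.ne', div_le_iff₀ (by positivity)]
    refine c2.trans (le_of_eq ?_)
    rw [Real.rpow_neg (by positivity), ← Real.inv_rpow (by positivity),
      ← Real.mul_rpow (by positivity) (by positivity)]
    congr 1; field_simp

lemma dens_lower (hN : 2 ≤ N) (hρ0 : 0 < ρ) (hρ1 : ρ ≤ 1 / (N : ℝ) ^ 2) {s : ℝ}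
    (hs : s = -Real.log N / Real.log ρ) {μ : Measure ℝ}
    [IsProbabilityMeasure μ] (hss : IsSelfSimilar N ρ μ) (d : ℕ → ℕ) (hd : ∀ i, d i < N)
    (c : ℝ) (hc : 0 < c) (h : upperDensity μ s (piMap N ρ d) < (2 * c) ^ (-s)) :
    ∃ n0, ∀ n, n0 ≤ n → c ≤ gam (Tn N ρ d n) := by
  obtain ⟨s0, s1, s2⟩ := s_facts hN hρ0 hρ1 hs
  have h4 := rho_lt hN hρ1
  have hN0 : (0:ℝ) < N := by exact_mod_cast (by omega : 0 < N)
  unfold upperDensity at h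
  have ev := eventually_lt_of_limsup_lt h (by
    refine ⟨N, ?_⟩
    rw [eventually_map]
    have hmem : Ioo (0:ℝ) 1 ∈ 𝓝[>] (0:ℝ) := Ioo_mem_nhdsGT (by norm_num)
    filter_upwards [hmem] with r hr
    obtain ⟨hr0, hr1⟩ := hr
    obtain ⟨n, hn1, hn2⟩ := exists_nat_pow_near_of_lt_one hr0 hr1.le hρ0 (by linarith)
    have it := ball_iter hN hρ0 hρ1 hss n d hd r hn2
    change μ.real (Ioo (piMap N ρ d - r) (piMap N ρ d + r)) / _ ≤ _
    rw [div_le_iff₀ (by positivity)]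
    have b1 : μ.real (Ioo (piMap N ρ d - r) (piMap N ρ d + r)) ≤ (N:ℝ)⁻¹ ^ n := by
      rw [it]
      exact mul_le_of_le_one_right (by positivity) measureReal_le_one
    have b2 : (N:ℝ)⁻¹ ^ (n + 1) ≤ (2 * r) ^ s := by
      have := pow_rpow hN hρ0 hρ1 hs (n + 1) (1/2) (by norm_num)
      rw [show (2:ℝ) * (1/2) = 1 by norm_num, Real.one_rpow, mul_one] at this
      rw [← this]
      apply Real.rpow_le_rpow (by positivity) _ s0.le
      linarith
    calc _ ≤ (N:ℝ)⁻¹ ^ n := b1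
      _ = N * (N:ℝ)⁻¹ ^ (n + 1) := by rw [pow_succ]; field_simp
      _ ≤ _ := by gcongr)
  have lim : Tendsto (fun n : ℕ => ρ ^ n * c) atTop (𝓝[>] 0) := by
    rw [tendsto_nhdsWithin_iff]
    constructor
    · have := (_root_.tendsto_pow_atTop_nhds_zero_of_lt_one hρ0.le (by linarith : ρ < 1)).mul_const c
      simpa using this
    · exact Filter.Eventually.of_forall fun n => by simp only [mem_Ioi]; positivity
  have ev2 := lim.eventually ev
  rw [eventually_atTop] at ev2
  obtain ⟨n0, hn0⟩ := ev2
  refine ⟨n0, fun n hn => ?_⟩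
  by_contra hlt
  push Not at hlt
  have h1 := hn0 n hn
  have h2 := ball_lower hN hρ0 hρ1 hss n d hd c hlt
  change μ.real (Ioo (piMap N ρ d - ρ ^ n * c) (piMap N ρ d + ρ ^ n * c)) / _ < _ at h1
  rw [pow_rpow hN hρ0 hρ1 hs n c hc.le, div_lt_iff₀ (by positivity), Real.rpow_neg (by positivity)] at h1
  have : 0 < (2 * c) ^ s := by positivity
  rw [← mul_assoc, mul_comm (((2 * c) ^ s)⁻¹), mul_assoc, inv_mul_cancel₀ this.ne', mul_one] at h1
  linarith

lemma blk_dens (hN : 2 ≤ N) (hρ0 : 0 < ρ) (hρ1 : ρ ≤ 1 / (N : ℝ) ^ 2) {s : ℝ}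
    (hs : s = -Real.log N / Real.log ρ) {μ : Measure ℝ}
    [IsProbabilityMeasure μ] (hss : IsSelfSimilar N ρ μ) {θ : ℕ → Bool} (hθ : IsTM θ)
    (e : ℕ → Bool) (n0 m : ℕ) (hb : IsBlk θ m (fun i => e (n0 + i)))
    (hpos : 0 < val N ρ θ - ρ ^ (2 ^ m)) :
    upperDensity μ s (val N ρ e) ≤ (2 * (val N ρ θ - ρ ^ (2 ^ m))) ^ (-s) := by
  apply dens_upper hN hρ0 hρ1 hs hss e n0 _ hpos
  intro n hn
  rw [gam_val hN hρ0 hρ1]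
  obtain ⟨k, rfl⟩ := Nat.exists_eq_add_of_le hn
  have := val_le_of_not_Llt hN hρ0 hρ1 (2 ^ m) θ _ (blk_not_Llt hθ m _ hb k)
  have e1 : nrm (fun i => e (n0 + i)) k = nrm e (n0 + k) := by
    ext i; simp only [nrm]; rw [add_assoc]
  rw [e1] at this
  linarith


/-- block sequence built from `u` -/
def mk (θ : ℕ → Bool) (m : ℕ) (u : ℕ → Bool) (i : ℕ) : Bool := u (i / 2 ^ m) == θ (i % 2 ^ m)

lemma mk_blk (θ : ℕ → Bool) (m : ℕ) (u : ℕ → Bool) : IsBlk θ m (mk θ m u) := by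
  refine ⟨u, fun a i hi => ?_⟩
  unfold mk
  rw [Nat.mul_add_div (by positivity), Nat.div_eq_of_lt hi, Nat.mul_add_mod, Nat.mod_eq_of_lt hi, add_zero]

lemma mk_start {θ : ℕ → Bool} (hθ : IsTM θ) (m : ℕ) (u : ℕ → Bool) (a : ℕ) :
    mk θ m u (2 ^ m * a) = u a := by
  have hp : 0 < 2 ^ m := by positivity
  unfold mk
  rw [Nat.mul_div_cancel_left _ hp, Nat.mul_mod_right, hθ.1]; simp

/-- first difference -/
lemma exists_first (u v : ℕ → Bool) (h : u ≠ v) : ∃ j, (∀ i < j, u i = v i) ∧ u j ≠ v j := by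
  have h : ∃ j, u j ≠ v j := Function.ne_iff.1 h
  classical
  refine ⟨Nat.find h, fun i hi => ?_, Nat.find_spec h⟩
  have := Nat.find_min h hi
  simpa using this

/-- boolean to `Fin 2` -/
def b2f (b : Bool) : Fin 2 := if b then 1 else 0

lemma dim_pos (hN : 2 ≤ N) (hρ0 : 0 < ρ) (hρ1 : ρ ≤ 1 / (N : ℝ) ^ 2) {θ : ℕ → Bool} (hθ : IsTM θ)
    (m : ℕ) : 0 < dimH (range fun u : ℕ → Bool => val N ρ (mk θ m u)) := by
  have h4 := rho_lt hN hρ1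
  set F : (ℕ → Bool) → ℝ := fun u => val N ρ (mk θ m u) with hF
  have hp : 0 < 2 ^ m := by positivity
  have hinj : Function.Injective F := by
    intro u v huv
    have := val_inj hN hρ0 hρ1 _ _ huv
    ext a
    rw [← mk_start hθ m u a, this, mk_start hθ]
  set G : ℝ → ℝ := fun x => Real.ofDigits (fun i => b2f (Function.invFun F x i)) with hG
  have hGF : ∀ u, G (F u) = Real.ofDigits (fun i => b2f (u i)) := by
    intro u; simp only [hG]; rw [Function.leftInverse_invFun hinj u]
  -- separation
  have sep : ∀ u v : ℕ → Bool, ∀ j, (∀ i < j, u i = v i) → u j ≠ v j →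
      (ρ ^ (2 ^ m)) ^ j * (1 / 2) ≤ |F u - F v| := by
    intro u v j h1 h2
    have e1 : ∀ i < 2 ^ m * j, mk θ m u i = mk θ m v i := by
      intro i hi
      unfold mk
      rw [h1 _ (Nat.div_lt_of_lt_mul hi)]
    rw [← pow_mul]
    have hu := mk_start hθ m u j
    have hv := mk_start hθ m v j
    cases hu' : u j <;> cases hv' : v j
    · simp [hu', hv'] at h2
    · have := val_diff hN hρ0 hρ1 (2 ^ m * j) _ _ e1 (hu.trans hu') (hv.trans hv')
      rw [abs_sub_comm]
      exact le_trans (by simp only [hF]; linarith) (le_abs_self _)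
    · have := val_diff hN hρ0 hρ1 (2 ^ m * j) _ _ (fun i hi => (e1 i hi).symm) (hv.trans hv') (hu.trans hu')
      exact le_trans (by simp only [hF]; linarith) (le_abs_self _)
    · simp [hu', hv'] at h2
  have hq0 : 0 < ρ ^ (2 ^ m) := by positivity
  have hq1 : ρ ^ (2 ^ m) < 1 := pow_lt_one₀ hρ0.le (by linarith) hp.ne'
  generalize ρ ^ (2 ^ m) = q at *
  have hlq : Real.log q < 0 := Real.log_neg hq0 hq1
  have hl2 : 0 < Real.log 2 := Real.log_pos (by norm_num)
  obtain ⟨r, hr⟩ : ∃ r : ℝ, r = -Real.log 2 / Real.log q := ⟨_, rfl⟩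
  have hr0 : 0 < r := by rw [hr]; exact div_pos_of_neg_of_neg (by linarith) hlq
  have hqr : q ^ r = (2:ℝ)⁻¹ := by
    rw [Real.rpow_def_of_pos hq0, hr, mul_div_cancel₀ _ hlq.ne, Real.exp_neg, Real.exp_log (by norm_num)]
  have hol : HolderOnWith (Real.toNNReal (2 ^ r)) (Real.toNNReal r) G (range F) := by
    rintro _ ⟨u, rfl⟩ _ ⟨v, rfl⟩
    by_cases huv : u = v
    · subst huv; simp
    obtain ⟨j, h1, h2⟩ := exists_first u v huv
    have s1 := sep u v j h1 h2
    have d1 : |G (F u) - G (F v)| ≤ ((2:ℝ)⁻¹) ^ j := by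
      rw [hGF, hGF]
      have := Real.abs_ofDigits_sub_ofDigits_le (x := fun i => b2f (u i)) (y := fun i => b2f (v i))
        (n := j) (fun i hi => by rw [h1 i hi])
      simpa using this
    have d2 : ((2:ℝ)⁻¹) ^ j ≤ 2 ^ r * |F u - F v| ^ r := by
      rw [← Real.mul_rpow (by norm_num) (abs_nonneg _), ← hqr, ← Real.rpow_natCast, ← Real.rpow_mul hq0.le,
        mul_comm r, Real.rpow_mul hq0.le, Real.rpow_natCast]
      apply Real.rpow_le_rpow (by positivity) _ hr0.le
      linarith
    rw [edist_dist, edist_dist, Real.dist_eq, Real.dist_eq, Real.coe_toNNReal _ hr0.le,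
      ENNReal.ofReal_rpow_of_nonneg (abs_nonneg _) hr0.le]
    change _ ≤ ENNReal.ofReal (2 ^ r) * _
    rw [← ENNReal.ofReal_mul (by positivity)]
    exact ENNReal.ofReal_le_ofReal (d1.trans d2)
  have himg : Icc (0:ℝ) 1 ⊆ G '' (range F) := by
    intro y hy
    obtain ⟨w, -, hw⟩ := Real.ofDigits_SurjOn (b := 2) (by norm_num) hy
    refine ⟨F (fun i => w i == 1), mem_range_self _, ?_⟩
    rw [hGF, ← hw]
    congr 1; ext1 i
    unfold b2f
    generalize w i = z
    fin_cases z <;> rfl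
  have hdim : (1:ℝ≥0∞) ≤ dimH (G '' (range F)) := by
    have := Real.dimH_of_nonempty_interior (s := Icc (0:ℝ) 1) (by rw [interior_Icc]; exact ⟨1/2, by norm_num⟩)
    rw [Module.finrank_self, Nat.cast_one] at this
    rw [← this]; exact dimH_mono himg
  have hle := hol.dimH_image_le (by simpa using hr0)
  by_contra h0
  have h0 : dimH (range F) = 0 := by simpa using h0
  rw [h0, ENNReal.zero_div] at hle
  exact absurd (hdim.trans hle) (by norm_num)

end aux


section main
variable {N : ℕ} {ρ : ℝ}

lemma th_dig (hN : 2 ≤ N) (th : ℕ → ℕ) (hth1 : th 1 = N - 1)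
    (hth2 : ∀ n j : ℕ, 1 ≤ j → j ≤ 2 ^ n → th (2 ^ n + j) = N - 1 - th j) :
    ∃ θ : ℕ → Bool, IsTM θ ∧ ∀ i, th (i + 1) = dig N θ i := by
  have key : ∀ k, th (k + 1) = 0 ∨ th (k + 1) = N - 1 := by
    intro k
    induction k using Nat.strong_induction_on with
    | _ k ih =>
      rcases Nat.eq_zero_or_pos k with rfl | hk
      · right; exact hth1
      · have h1 : 2 ^ Nat.log 2 k ≤ k := Nat.pow_log_le_self 2 hk.ne'
        have h2 : k < 2 ^ (Nat.log 2 k + 1) := Nat.lt_pow_succ_log_self (by norm_num) k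
        have h3 : 0 < 2 ^ Nat.log 2 k := by positivity
        rw [pow_succ] at h2
        have := hth2 (Nat.log 2 k) (k - 2 ^ Nat.log 2 k + 1) (by omega) (by omega)
        have h4 : 2 ^ Nat.log 2 k + (k - 2 ^ Nat.log 2 k + 1) = k + 1 := by omega
        rw [h4] at this
        rcases ih (k - 2 ^ Nat.log 2 k) (by omega) with h | h <;> rw [h] at this <;> omega
  refine ⟨fun i => decide (th (i + 1) = N - 1), ⟨by simp [hth1], fun n j hj => ?_⟩, fun i => ?_⟩
  · have := hth2 n (j + 1) (by omega) (by omega)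
    rw [← add_assoc] at this
    simp only [this]
    rcases key j with h | h <;> rw [h]
    · have h0 : 0 ≠ N - 1 := by omega
      simp [h0]
    · have h0 : 0 ≠ N - 1 := by omega
      simp [h0]
  · have h0 : 0 ≠ N - 1 := by omega
    unfold dig
    rcases key i with h | h <;> simp [h, h0]

lemma dig_of_gam (hN : 2 ≤ N) (hρ0 : 0 < ρ) (hρ1 : ρ ≤ 1 / (N : ℝ) ^ 2) (d : ℕ → ℕ)
    (hd : ∀ i, d i < N) (n : ℕ) (h : 1 - ρ < gam (Tn N ρ d n)) : d n = 0 ∨ d n = N - 1 := by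
  have hrec := piMap_rec hρ0 (rho_lt hN hρ1) (fun i => d (n + i)) (fun i => hd _)
  have h0 := piMap_nonneg hN hρ0 hρ1 (fun i => d (n + (1 + i)))
  have h1 := piMap_le hN hρ0 hρ1 (fun i => d (n + (1 + i))) (fun i => hd _)
  have hR := R_ge hN hρ0 hρ1
  have hRm := R_mul (ρ := ρ) hN
  simp only [add_zero] at hrec
  unfold gam Tn at h
  rw [hrec] at h
  set y := piMap N ρ (fun i => d (n + (1 + i)))
  have hy0 : 0 ≤ ρ * y := by positivity
  have hy1 : ρ * y ≤ ρ := by nlinarith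
  rcases lt_max_iff.1 h with h | h
  · right
    by_contra hne
    have h2 : d n + 2 ≤ N := by have := hd n; omega
    have h3 : (d n : ℝ) + 2 ≤ N := by exact_mod_cast h2
    nlinarith
  · left
    by_contra hne
    have h3 : (1 : ℝ) ≤ d n := by exact_mod_cast Nat.one_le_iff_ne_zero.2 hne
    nlinarith

lemma part_one (hN : 2 ≤ N) (hρ0 : 0 < ρ) (hρ1 : ρ ≤ 1 / (N : ℝ) ^ 2) {s : ℝ}
    (hs : s = -Real.log N / Real.log ρ) {μ : Measure ℝ}
    [IsProbabilityMeasure μ] (hss : IsSelfSimilar N ρ μ) {θ : ℕ → Bool} (hθ : IsTM θ)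
    (hP : 1 - ρ ≤ val N ρ θ) (hpow : Tendsto (fun m : ℕ => ρ ^ (2 ^ m)) atTop (𝓝 0)) (b : ℝ)
    (hb : b < (2 * val N ρ θ) ^ (-s)) :
    {x ∈ cantorE N ρ | upperDensity μ s x ≤ b}.Countable := by
  have hρ4 := rho_lt hN hρ1
  have hPpos : 0 < val N ρ θ := by linarith
  have hcont : ContinuousAt (fun c : ℝ => (2 * c) ^ (-s)) (val N ρ θ) :=
    ContinuousAt.rpow_const (by fun_prop) (Or.inl (by positivity))
  have hev : ∀ᶠ c in 𝓝[>] (val N ρ θ), b < (2 * c) ^ (-s) :=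
    (hcont.eventually (lt_mem_nhds hb)).filter_mono nhdsWithin_le_nhds
  obtain ⟨c, hbc, hc⟩ := (hev.and self_mem_nhdsWithin).exists
  have hc : val N ρ θ < c := hc
  obtain ⟨m, hm⟩ := (hpow.eventually (gt_mem_nhds (show 0 < c - val N ρ θ by linarith))).exists
  refine (evPer_countable.image (piMap N ρ)).mono ?_
  rintro x ⟨⟨d, hd, rfl⟩, hx⟩
  refine ⟨d, ?_, rfl⟩
  obtain ⟨n0, hn0⟩ := dens_lower hN hρ0 hρ1 hs hss d hd c (by linarith) (lt_of_le_of_lt hx hbc)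
  have hdig : ∀ i, d (n0 + i) = dig N (fun i => decide (d (n0 + i) = N - 1)) i := by
    intro i
    have h0 : 0 ≠ N - 1 := by omega
    unfold dig
    rcases dig_of_gam hN hρ0 hρ1 d hd (n0 + i) (by have := hn0 (n0 + i) (by omega); linarith)
      with h | h <;> simp [h, h0]
  set e : ℕ → Bool := fun i => decide (d (n0 + i) = N - 1) with he
  have hE : EvPer e := by
    refine evPer_of_Llt hθ e m fun n => ?_
    by_contra hL
    have h1 := val_le_of_not_Llt hN hρ0 hρ1 _ _ _ hL
    have h2 := hn0 (n0 + n) (by omega)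
    have h3 : Tn N ρ d (n0 + n) = val N ρ (fun i => e (n + i)) := by
      unfold Tn val
      congr 1
      funext i
      rw [add_assoc, hdig (n + i)]
      rfl
    rw [h3, gam_val hN hρ0 hρ1] at h2
    linarith
  obtain ⟨n, p, hp, hnp⟩ := hE
  refine ⟨n0 + n, p, hp, fun k hk => ?_⟩
  obtain ⟨j, rfl⟩ := Nat.exists_eq_add_of_le (show n0 ≤ k by omega)
  rw [add_assoc, hdig, hdig]
  unfold dig
  rw [hnp j (by omega)]

end main

/-- Theorem 2 (B): the critical value `b_c` for `E^*(b) = {x ∈ E : Θ^{*s}(μ,x) ≤ b}`. -/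
theorem critical_value_upper (N : ℕ) (hN : 2 ≤ N) (ρ : ℝ) (hρ0 : 0 < ρ)
    (hρ1 : ρ ≤ 1 / (N : ℝ) ^ 2) (s : ℝ) (hs : s = -Real.log N / Real.log ρ)
    (μ : Measure ℝ) (hprob : IsProbabilityMeasure μ) (hss : IsSelfSimilar N ρ μ)
    (th : ℕ → ℕ) (hth1 : th 1 = N - 1)
    (hth2 : ∀ n j : ℕ, 1 ≤ j → j ≤ 2 ^ n → th (2 ^ n + j) = N - 1 - th j)
    (b : ℝ) :
    (b < (2 * R N ρ * ∑' i : ℕ, (th (i + 1) : ℝ) * ρ ^ i) ^ (-s) →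
        {x ∈ cantorE N ρ | upperDensity μ s x ≤ b}.Countable) ∧
    (b = (2 * R N ρ * ∑' i : ℕ, (th (i + 1) : ℝ) * ρ ^ i) ^ (-s) →
        ¬ {x ∈ cantorE N ρ | upperDensity μ s x ≤ b}.Countable) ∧
    ((2 * R N ρ * ∑' i : ℕ, (th (i + 1) : ℝ) * ρ ^ i) ^ (-s) < b →
        0 < dimH {x ∈ cantorE N ρ | upperDensity μ s x ≤ b}) := by

  have := hprob
  obtain ⟨θ, hθ, hdig⟩ := th_dig hN th hth1 hth2
  have hEq : 2 * R N ρ * ∑' i : ℕ, (th (i + 1) : ℝ) * ρ ^ i = 2 * val N ρ θ := by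
    unfold val piMap
    rw [mul_assoc]
    simp only [hdig]
  rw [hEq]
  have hρ4 := rho_lt hN hρ1
  have hP : 1 - ρ ≤ val N ρ θ := by
    rw [val_rec hN hρ0 hρ1 θ, hθ.1]
    have := mul_nonneg hρ0.le (val_nonneg hN hρ0 hρ1 (fun i => θ (1 + i)))
    simpa using this
  have hpow : Tendsto (fun m : ℕ => ρ ^ (2 ^ m)) atTop (𝓝 0) :=
    (_root_.tendsto_pow_atTop_nhds_zero_of_lt_one hρ0.le (by linarith)).comp
      (tendsto_pow_atTop_atTop_of_one_lt (r := (2:ℕ)) (by norm_num))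
  have hpos : ∀ m : ℕ, 0 < val N ρ θ - ρ ^ (2 ^ m) := by
    intro m
    have : ρ ^ (2 ^ m) ≤ ρ := pow_le_of_le_one hρ0.le (by linarith) (by positivity)
    linarith
  have hlim : Tendsto (fun m : ℕ => (2 * (val N ρ θ - ρ ^ (2 ^ m))) ^ (-s)) atTop
      (𝓝 ((2 * val N ρ θ) ^ (-s))) := by
    have h1 : Tendsto (fun m : ℕ => 2 * (val N ρ θ - ρ ^ (2 ^ m))) atTop
        (𝓝 (2 * val N ρ θ)) := by
      simpa using (tendsto_const_nhds.sub hpow).const_mul 2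
    exact h1.rpow_const (Or.inl (by linarith))
  refine ⟨part_one hN hρ0 hρ1 hs hss hθ hP hpow b, ?_, ?_⟩
  · rintro rfl hcount
    have hinj : Function.Injective (fun u : ℕ → Bool => val N ρ (fam θ u)) := by
      intro u v huv
      have := val_inj hN hρ0 hρ1 _ _ huv
      funext n
      rw [← fam_pow hθ u n, this, fam_pow hθ]
    have hsub : range (fun u : ℕ → Bool => val N ρ (fam θ u)) ⊆
        {x ∈ cantorE N ρ | upperDensity μ s x ≤ (2 * val N ρ θ) ^ (-s)} := by
      rintro _ ⟨u, rfl⟩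
      refine ⟨⟨_, dig_lt hN _, rfl⟩, ?_⟩
      exact ge_of_tendsto' hlim fun m =>
        blk_dens hN hρ0 hρ1 hs hss hθ (fam θ u) (2 ^ m) m (fam_blk hθ u m) (hpos m)
    have h1 := (hcount.mono hsub)
    have h2 : (univ : Set (ℕ → Bool)).Countable := by
      have := h1.preimage_of_injOn (f := fun u : ℕ → Bool => val N ρ (fam θ u)) hinj.injOn
      simpa using this
    have h3 : Countable (ℕ → Bool) := countable_univ_iff.1 h2
    obtain ⟨F, hF⟩ := exists_surjective_nat (ℕ → Bool)
    obtain ⟨n, hn⟩ := hF (fun k => !(F k k))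
    have h4 := congrFun hn n
    revert h4
    cases F n n <;> simp
  · intro hb
    obtain ⟨m, hm⟩ := (hlim.eventually (gt_mem_nhds hb)).exists
    refine lt_of_lt_of_le (dim_pos hN hρ0 hρ1 hθ m) (dimH_mono ?_)
    rintro _ ⟨u, rfl⟩
    refine ⟨⟨_, dig_lt hN _, rfl⟩, ?_⟩
    refine le_trans (blk_dens hN hρ0 hρ1 hs hss hθ _ 0 m ?_ (hpos m)) hm.le
    simpa using mk_blk θ m u

end HomogeneousCantorDensity
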